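/- Let G be a finitely generated abelian sub-semigroup of M_n(ℂ), and let P ∈ GL(n,ℂ) be such that P⁻¹ G P ⊆ K_{η,r}(ℂ). Set V = P(U) where U = ∏_{k=1}^r (ℂ* × ℂ^{n_k−1}). Then the following are equivalent: (i) G has a dense orbit in ℂⁿ; (ii) J_G(v_0) = ℂⁿ where v_0 = P u_0 and u_0 is the vector whose k-th block is (1,0,…,0) ∈ ℂ^{n_k}; (iii) the orbit G(v_0) is dense in ℂⁿ. -/

import Mathlib

open Filter Topology Matrix

/-- `n × n` lower triangular complex matrices whose diagonal entries are all equal. -/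
def IsTn {n : ℕ} (A : Matrix (Fin n) (Fin n) ℂ) : Prop :=
  (∀ i j : Fin n, i < j → A i j = 0) ∧ ∀ i j : Fin n, A i i = A j j

/-- `F_G`: the span of the vectors `(B - μ_B I) e_i`, `B ∈ G`, `1 ≤ i ≤ n-1`. -/
noncomputable def FG {n : ℕ} (G : Set (Matrix (Fin n) (Fin n) ℂ)) : Submodule ℂ (Fin n → ℂ) :=
  Submodule.span ℂ {v | ∃ B ∈ G, ∃ i : Fin n, (i : ℕ) < n - 1 ∧
    v = (B - B i i • (1 : Matrix (Fin n) (Fin n) ℂ)).mulVec (Pi.single i 1)}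

/-- The sub-semigroup generated by matrices `A 1, …, A p`. -/
def genSG {n p : ℕ} (A : Fin p → Matrix (Fin n) (Fin n) ℂ) :
    Set (Matrix (Fin n) (Fin n) ℂ) :=
  {B | ∃ k : Fin p → ℕ, 0 < ∑ j, k j ∧ B = (List.ofFn fun j => A j ^ k j).prod}

/-- The extended limit set `J_G(x)` for the semigroup generated by `A 1, …, A p`. -/
def JSet {n p : ℕ} (A : Fin p → Matrix (Fin n) (Fin n) ℂ) (x : Fin n → ℂ) :
    Set (Fin n → ℂ) :=
  {y | ∃ (xs : ℕ → Fin n → ℂ) (k : ℕ → Fin p → ℕ),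
    Tendsto (fun m => ∑ j, k m j) atTop atTop ∧
    Tendsto xs atTop (𝓝 x) ∧
    Tendsto (fun m => ((List.ofFn fun j => A j ^ k m j).prod).mulVec (xs m)) atTop (𝓝 y)}

/-- A commuting family of endomorphisms with a proper common invariant subspace `W` has a common
eigenfunctional vanishing on `W`. -/
theorem exists_common_eigenfunctional {K E ι : Type*} [Field K] [IsAlgClosed K] [AddCommGroup E]
    [Module K E] [FiniteDimensional K E] (T : ι → Module.End K E)
    (hT : ∀ i j, T i * T j = T j * T i) (W : Submodule K E) (hW : W ≠ ⊤)
    (hinv : ∀ i, ∀ x ∈ W, T i x ∈ W) :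
    ∃ (f : E →ₗ[K] K) (χ : ι → K), f ≠ 0 ∧ (∀ x ∈ W, f x = 0) ∧
      ∀ i x, f (T i x) = χ i * f x := by
  obtain ⟨N, ⟨hNtop, hWN, hN⟩, hmax⟩ := wellFounded_gt.has_min
    {N : Submodule K E | N ≠ ⊤ ∧ W ≤ N ∧ ∀ i, ∀ x ∈ N, T i x ∈ N} ⟨W, hW, le_rfl, hinv⟩
  have hscalar : ∀ i, ∃ c : K, ∀ x, T i x - c • x ∈ N := by
    intro i
    have : Nontrivial (E ⧸ N) := Submodule.Quotient.nontrivial_iff.2 hNtop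
    obtain ⟨c, hc⟩ := Module.End.exists_eigenvalue (N.mapQ N (T i) (hN i))
    refine ⟨c, ?_⟩
    let R : Submodule K E := N ⊔ LinearMap.range (T i - c • (1 : Module.End K E))
    have hRinv : ∀ j, ∀ x ∈ R, T j x ∈ R := by
      intro j x hx
      obtain ⟨y, hy, z, ⟨w, rfl⟩, rfl⟩ := Submodule.mem_sup.1 hx
      rw [map_add]
      refine Submodule.add_mem_sup (hN j y hy) ⟨T j w, ?_⟩
      have := LinearMap.congr_fun (hT i j) w
      simp only [Module.End.mul_apply] at this
      simp [this]
    have hRtop : R ≠ ⊤ := by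
      intro htop
      have hsurj : Function.Surjective
          (N.mapQ N (T i) (hN i) - c • (1 : Module.End K (E ⧸ N))) := by
        intro q
        obtain ⟨x, rfl⟩ := N.mkQ_surjective q
        obtain ⟨y, hy, z, ⟨w, rfl⟩, hx⟩ := Submodule.mem_sup.1 (htop ▸ Submodule.mem_top : x ∈ R)
        refine ⟨N.mkQ w, ?_⟩
        rw [← hx, map_add, (by simpa using hy : N.mkQ y = 0)]
        simp
      have hinj := LinearMap.injective_iff_surjective.2 hsurj
      obtain ⟨q, hq⟩ := hc.exists_hasEigenvector
      refine hq.2 (hinj ?_)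
      simp [hq.apply_eq_smul]
    have hRN : ¬ N < R := fun h => hmax R ⟨hRtop, hWN.trans le_sup_left, hRinv⟩ h
    have hle : R ≤ N := by
      by_contra h
      exact hRN (lt_of_le_not_ge le_sup_left h)
    intro x
    exact hle (Submodule.mem_sup_right ⟨x, by simp⟩)
  choose χ hχ using hscalar
  obtain ⟨f, hf, hfN⟩ := Submodule.exists_le_ker_of_lt_top N (lt_top_iff_ne_top.2 hNtop)
  refine ⟨f, χ, hf, fun x hx => hfN (hWN hx), fun i x => ?_⟩
  have := hfN (hχ i x)
  rw [LinearMap.mem_ker, map_sub, map_smul, sub_eq_zero] at this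
  simpa using this

/-- The elements of an abelian finitely generated matrix semigroup commute. -/
theorem genSG_commute {n p : ℕ} {A : Fin p → Matrix (Fin n) (Fin n) ℂ}
    (hcomm : ∀ i j, A i * A j = A j * A i) {B C : Matrix (Fin n) (Fin n) ℂ}
    (hB : B ∈ genSG A) (hC : C ∈ genSG A) : B * C = C * B := by
  obtain ⟨k, -, rfl⟩ := hB
  obtain ⟨l, -, rfl⟩ := hC
  refine Commute.list_prod_left _ _ fun x hx => Commute.list_prod_right _ _ fun y hy => ?_
  obtain ⟨i, rfl⟩ := (List.mem_ofFn' _ _).1 hx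
  obtain ⟨j, rfl⟩ := (List.mem_ofFn' _ _).1 hy
  exact Commute.pow_pow (hcomm i j) _ _

/-- The elements of the algebra generated by an abelian matrix semigroup commute. -/
theorem adjoin_genSG_commute {n p : ℕ} {A : Fin p → Matrix (Fin n) (Fin n) ℂ}
    (hcomm : ∀ i j, A i * A j = A j * A i) {B C : Matrix (Fin n) (Fin n) ℂ}
    (hB : B ∈ Algebra.adjoin ℂ (genSG A)) (hC : C ∈ Algebra.adjoin ℂ (genSG A)) :
    B * C = C * B :=
  Algebra.commute_of_mem_adjoin_of_forall_mem_commute hC fun _ hC' =>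
    (Algebra.commute_of_mem_adjoin_of_forall_mem_commute hB
      fun _ hB' => genSG_commute hcomm hC' hB').symm

/-- In block triangular form, every common eigenfunctional of the semigroup shares its weight with
a common eigenfunctional taking the value `1` at the base vector. -/
theorem exists_eigenfunctional_same_weight {n r : ℕ}
    (S : Set (Matrix (Fin n) (Fin n) ℂ)) (P : (Matrix (Fin n) (Fin n) ℂ)ˣ)
    (nn : Fin r → ℕ) (hpos : ∀ k, 0 < nn k) (e : Fin n ≃ ((k : Fin r) × Fin (nn k)))
    (hconj : ∀ B ∈ S, ∃ b : (k : Fin r) → Matrix (Fin (nn k)) (Fin (nn k)) ℂ,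
      (∀ k, IsTn (b k)) ∧
      ((↑P⁻¹ : Matrix (Fin n) (Fin n) ℂ) * B * (P : Matrix (Fin n) (Fin n) ℂ)).submatrix
          e.symm e.symm = Matrix.blockDiagonal' b)
    (f : (Fin n → ℂ) →ₗ[ℂ] ℂ) (hf : f ≠ 0) (χ : S → ℂ)
    (hχ : ∀ (B : S) x, f (B.1 *ᵥ x) = χ B * f x) :
    ∃ g : (Fin n → ℂ) →ₗ[ℂ] ℂ,
      g ((P : Matrix (Fin n) (Fin n) ℂ) *ᵥ fun i => if ((e i).2 : ℕ) = 0 then 1 else 0) = 1 ∧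
      ∀ (B : S) x, g (B.1 *ᵥ x) = χ B * g x := by
  let Q : Matrix (Fin n) (Fin n) ℂ := P
  let Q' : Matrix (Fin n) (Fin n) ℂ := ↑P⁻¹
  have hQQ' : Q * Q' = 1 := P.mul_inv
  have hQ'Q : Q' * Q = 1 := P.inv_mul
  have expand : ∀ x : Fin n → ℂ, f (Q *ᵥ x) =
      ∑ s, x (e.symm s) * f (Q *ᵥ Pi.single (e.symm s) 1) := by
    intro x
    conv_lhs => rw [pi_eq_sum_univ' x, Matrix.mulVec_sum, map_sum, ← e.symm.sum_comp]
    refine Finset.sum_congr rfl fun s _ => ?_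
    rw [Matrix.mulVec_smul, map_smul, smul_eq_mul]
  obtain ⟨⟨k, i₀⟩, hs⟩ : ∃ s, f (Q *ᵥ Pi.single (e.symm s) 1) ≠ 0 := by
    by_contra! h
    apply hf
    refine LinearMap.ext fun x => ?_
    have := expand (Q' *ᵥ x)
    rw [Matrix.mulVec_mulVec, hQQ', Matrix.one_mulVec] at this
    exact this.trans (Finset.sum_eq_zero fun s _ => by rw [h s, mul_zero])
  obtain ⟨i, hi, himax⟩ := Finset.exists_max_image
    (Finset.univ.filter fun i => f (Q *ᵥ Pi.single (e.symm ⟨k, i⟩) 1) ≠ 0) id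
    ⟨i₀, Finset.mem_filter.2 ⟨Finset.mem_univ _, hs⟩⟩
  simp only [Finset.mem_filter, Finset.mem_univ, true_and, id] at hi himax
  have hweight : ∀ (B : S) (b : (k : Fin r) → Matrix (Fin (nn k)) (Fin (nn k)) ℂ),
      (∀ k, IsTn (b k)) → (Q' * B.1 * Q).submatrix e.symm e.symm = Matrix.blockDiagonal' b →
      χ B = b k i i := by
    intro B b hb hBb
    have h1 := hχ B (Q *ᵥ Pi.single (e.symm ⟨k, i⟩) 1)
    have h2 : B.1 *ᵥ (Q *ᵥ Pi.single (e.symm ⟨k, i⟩) 1)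
        = Q *ᵥ ((Q' * B.1 * Q) *ᵥ Pi.single (e.symm ⟨k, i⟩) 1) := by
      simp only [Matrix.mulVec_mulVec, ← mul_assoc, hQQ', one_mul]
    rw [h2, expand, Finset.sum_eq_single ⟨k, i⟩] at h1
    · have h3 := congrFun (congrFun hBb ⟨k, i⟩) ⟨k, i⟩
      rw [Matrix.submatrix_apply, Matrix.blockDiagonal'_apply_eq] at h3
      rw [Matrix.mulVec_single_one, Matrix.col_apply, h3] at h1
      exact (mul_right_cancel₀ hi h1).symm
    · rintro ⟨k', l⟩ - hne
      have h3 := congrFun (congrFun hBb ⟨k', l⟩) ⟨k, i⟩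
      rw [Matrix.submatrix_apply] at h3
      rw [Matrix.mulVec_single_one, Matrix.col_apply, h3]
      by_cases hk : k' = k
      · subst hk
        rw [Matrix.blockDiagonal'_apply_eq]
        rcases lt_trichotomy l i with hl | hl | hl
        · rw [(hb _).1 _ _ hl, zero_mul]
        · exact absurd (by rw [hl]) hne
        · rw [mul_eq_zero]
          right
          by_contra h
          exact absurd (himax l h) (not_le.2 hl)
      · rw [Matrix.blockDiagonal'_apply_ne _ _ _ hk, zero_mul]
    · simp
  let z : Fin (nn k) := ⟨0, hpos k⟩
  refine ⟨LinearMap.proj (e.symm ⟨k, z⟩) ∘ₗ Q'.mulVecLin, ?_, fun B x => ?_⟩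
  · change (Q' *ᵥ (Q *ᵥ _)) _ = _
    rw [Matrix.mulVec_mulVec, hQ'Q, Matrix.one_mulVec]
    rw [e.apply_symm_apply, if_pos rfl]
  · obtain ⟨b, hb, hBb⟩ := hconj B.1 B.2
    rw [hweight B b hb hBb, (hb k).2 i z]
    change (Q' *ᵥ (B.1 *ᵥ x)) _ = _ * (Q' *ᵥ x) _
    have h2 : Q' *ᵥ (B.1 *ᵥ x) = (Q' * B.1 * Q) *ᵥ (Q' *ᵥ x) := by
      simp only [Matrix.mulVec_mulVec, mul_assoc, hQQ', mul_one]
    rw [h2, Matrix.mulVec, dotProduct, ← e.symm.sum_comp, Finset.sum_eq_single ⟨k, z⟩]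
    · have h3 := congrFun (congrFun hBb ⟨k, z⟩) ⟨k, z⟩
      rw [Matrix.submatrix_apply, Matrix.blockDiagonal'_apply_eq] at h3
      exact congrArg (· * _) h3
    · rintro ⟨k', l⟩ - hne
      have h3 := congrFun (congrFun hBb ⟨k, z⟩) ⟨k', l⟩
      rw [Matrix.submatrix_apply] at h3
      refine mul_eq_zero_of_left (h3.trans ?_) _
      by_cases hk : k = k'
      · subst hk
        rw [Matrix.blockDiagonal'_apply_eq]
        refine (hb _).1 _ _ (lt_of_le_of_ne (Fin.mk_le_of_le_val (Nat.zero_le _)) ?_)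
        rintro rfl
        exact hne rfl
      · rw [Matrix.blockDiagonal'_apply_ne _ _ _ hk]
    · simp

/-- A vector with dense orbit has full extended limit set. -/
theorem JSet_eq_univ_of_dense {n p : ℕ} (hn : 0 < n) (A : Fin p → Matrix (Fin n) (Fin n) ℂ)
    (x : Fin n → ℂ) (hd : Dense {w : Fin n → ℂ | ∃ B ∈ genSG A, w = B *ᵥ x}) :
    JSet A x = Set.univ := by
  have : Nonempty (Fin n) := ⟨⟨0, hn⟩⟩
  have hne (y : Fin n → ℂ) : NeBot (𝓝[≠] y) := Module.punctured_nhds_neBot ℂ (Fin n → ℂ) y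
  refine Set.eq_univ_of_forall fun y => ?_
  have key : ∀ m : ℕ, ∃ k : Fin p → ℕ, m < ∑ j, k j ∧
      dist ((List.ofFn fun j => A j ^ k j).prod *ᵥ x) y < 1 / ((m : ℝ) + 1) := by
    intro m
    have hfin : Set.Finite ((fun k : Fin p → ℕ => (List.ofFn fun j => A j ^ k j).prod *ᵥ x) ''
        Set.Iic fun _ => m) := (Set.finite_Iic _).image _
    obtain ⟨w, ⟨⟨B, ⟨k, -, rfl⟩, rfl⟩, hk⟩, hw⟩ :=
      (hd.sdiff_finite hfin).exists_dist_lt y (Nat.one_div_pos_of_nat (n := m) (α := ℝ))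
    refine ⟨k, ?_, by rwa [dist_comm]⟩
    by_contra! hle
    exact hk ⟨k, fun j => (Finset.single_le_sum (fun _ _ => Nat.zero_le _)
      (Finset.mem_univ j)).trans hle, rfl⟩
  choose k hk hdist using key
  refine ⟨fun _ => x, k, tendsto_atTop_mono (fun m => (hk m).le) tendsto_id,
    tendsto_const_nhds, ?_⟩
  rw [tendsto_iff_dist_tendsto_zero]
  exact squeeze_zero (fun _ => dist_nonneg) (fun m => (hdist m).le)
    tendsto_one_div_add_atTop_nhds_zero_nat

/-- A cyclic vector of an abelian matrix semigroup with full extended limit set has dense orbit. -/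
theorem dense_orbit_of_JSet_eq_univ {n p : ℕ} {A : Fin p → Matrix (Fin n) (Fin n) ℂ}
    (hcomm : ∀ i j, A i * A j = A j * A i) {v : Fin n → ℂ}
    (hcyc : ∀ x, ∃ C ∈ Algebra.adjoin ℂ (genSG A), C *ᵥ v = x)
    (hJ : JSet A v = Set.univ) :
    Dense {w : Fin n → ℂ | ∃ B ∈ genSG A, w = B *ᵥ v} := by
  let 𝒜 := Algebra.adjoin ℂ (genSG A)
  let L : 𝒜 →ₗ[ℂ] (Fin n → ℂ) := ((Matrix.mulVecBilin ℂ ℂ).flip v) ∘ₗ 𝒜.val.toLinearMap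
  obtain ⟨R, hR⟩ := L.exists_rightInverse_of_surjective <| LinearMap.range_eq_top.2 fun x => by
    obtain ⟨C, hC, hCx⟩ := hcyc x
    exact ⟨⟨C, hC⟩, hCx⟩
  let E : (Fin n → ℂ) →ₗ[ℂ] Matrix (Fin n) (Fin n) ℂ := 𝒜.val.toLinearMap ∘ₗ R
  have hEmem (x) : E x ∈ 𝒜 := (R x).2
  have hEv (x) : E x *ᵥ v = x := LinearMap.congr_fun hR x
  have hEcont : Continuous E := E.continuous_of_finiteDimensional
  have hE1 : E v = 1 := by
    refine Matrix.ext_of_mulVec_single fun i => ?_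
    obtain ⟨C, hC, hCx⟩ := hcyc (Pi.single i 1)
    rw [← hCx, Matrix.mulVec_mulVec, adjoin_genSG_commute hcomm (hEmem v) hC,
      ← Matrix.mulVec_mulVec, hEv, Matrix.one_mulVec]
  intro y
  obtain ⟨xs, k, hk, hxs, hy⟩ : y ∈ JSet A v := hJ.symm ▸ Set.mem_univ y
  let B : ℕ → Matrix (Fin n) (Fin n) ℂ := fun m => (List.ofFn fun j => A j ^ k m j).prod
  have hpos : ∀ᶠ m in atTop, B m ∈ genSG A := by
    filter_upwards [hk.eventually_gt_atTop 0] with m hm using ⟨k m, hm, rfl⟩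
  have hElim : Tendsto (fun m => E (xs m)) atTop (𝓝 1) := hE1 ▸ (hEcont.tendsto v).comp hxs
  have hdet : Tendsto (fun m => (E (xs m)).det) atTop (𝓝 1) := by
    simpa [Function.comp_def] using
      ((continuous_id.matrix_det).tendsto (1 : Matrix (Fin n) (Fin n) ℂ)).comp hElim
  have hadj : Tendsto (fun m => (E (xs m)).adjugate) atTop (𝓝 1) := by
    simpa [Function.comp_def] using
      ((continuous_id.matrix_adjugate).tendsto (1 : Matrix (Fin n) (Fin n) ℂ)).comp hElim
  have hmul : Tendsto (fun m => (E (xs m)).adjugate *ᵥ (B m *ᵥ xs m)) atTop (𝓝 y) := by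
    have hc : Continuous fun q : Matrix (Fin n) (Fin n) ℂ × (Fin n → ℂ) => q.1 *ᵥ q.2 :=
      continuous_fst.matrix_mulVec continuous_snd
    have := (hc.tendsto (1, y)).comp (hadj.prodMk_nhds hy)
    rwa [Matrix.one_mulVec] at this
  have hlim : Tendsto (fun m => ((E (xs m)).det)⁻¹ • (E (xs m)).adjugate *ᵥ (B m *ᵥ xs m))
      atTop (𝓝 y) := by
    simpa using (hdet.inv₀ one_ne_zero).smul hmul
  refine mem_closure_of_tendsto hlim ?_
  filter_upwards [hpos, hdet.eventually_ne one_ne_zero] with m hm hm0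
  refine ⟨B m, hm, ?_⟩
  have hBx : B m *ᵥ xs m = E (xs m) *ᵥ (B m *ᵥ v) := by
    rw [Matrix.mulVec_mulVec,
      adjoin_genSG_commute hcomm (hEmem _) (Algebra.subset_adjoin hm : B m ∈ 𝒜),
      ← Matrix.mulVec_mulVec, hEv]
  rw [hBx, Matrix.mulVec_mulVec, Matrix.adjugate_mul, Matrix.smul_mulVec, Matrix.one_mulVec,
    smul_smul, inv_mul_cancel₀ hm0, one_smul]

/-- If some element of the algebra generated by an abelian matrix semigroup maps `v` to a vector
with dense orbit, then `v` has dense orbit. -/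
theorem dense_orbit_of_dense_orbit {n p : ℕ} {A : Fin p → Matrix (Fin n) (Fin n) ℂ}
    (hcomm : ∀ i j, A i * A j = A j * A i) {v x : Fin n → ℂ}
    (hx : ∃ C ∈ Algebra.adjoin ℂ (genSG A), C *ᵥ v = x)
    (hd : Dense {w : Fin n → ℂ | ∃ B ∈ genSG A, w = B *ᵥ x}) :
    Dense {w : Fin n → ℂ | ∃ B ∈ genSG A, w = B *ᵥ v} := by
  obtain ⟨C, hC, rfl⟩ := hx
  have hswap : ∀ B ∈ genSG A, B *ᵥ (C *ᵥ v) = C *ᵥ (B *ᵥ v) := fun B hB => by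
    rw [Matrix.mulVec_mulVec, Matrix.mulVec_mulVec,
      adjoin_genSG_commute hcomm hC (Algebra.subset_adjoin hB)]
  have hsurj : Function.Surjective C.mulVec := by
    intro y
    have hclosed : IsClosed (LinearMap.range C.mulVecLin : Set (Fin n → ℂ)) :=
      Submodule.closed_of_finiteDimensional _
    refine closure_minimal ?_ hclosed (hd y)
    rintro w ⟨B, hB, rfl⟩
    exact ⟨B *ᵥ v, (hswap B hB).symm⟩
  have hunit : IsUnit C.det :=
    (Matrix.isUnit_iff_isUnit_det _).1 (Matrix.mulVec_surjective_iff_isUnit.1 hsurj)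
  have hinv (w : Fin n → ℂ) : C⁻¹ *ᵥ (C *ᵥ w) = w := by
    rw [Matrix.mulVec_mulVec, Matrix.nonsing_inv_mul _ hunit, Matrix.one_mulVec]
  have hcont : Continuous fun w : Fin n → ℂ => C⁻¹ *ᵥ w :=
    continuous_const.matrix_mulVec continuous_id
  have hrange : Function.Surjective fun w : Fin n → ℂ => C⁻¹ *ᵥ w := fun w => ⟨_, hinv w⟩
  refine (hrange.denseRange.dense_image hcont hd).mono ?_
  rintro _ ⟨w, ⟨B, hB, rfl⟩, rfl⟩
  exact ⟨B, hB, by simp only [hswap B hB, hinv]⟩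

/-- Corollary 1.3: for a finitely generated abelian sub-semigroup `G` of `M_n(ℂ)` with
`P⁻¹ G P ⊆ K_{η,r}(ℂ)`: `G` is hypercyclic ↔ `J_G(v₀) = ℂⁿ` ↔ `G(v₀)` is dense,
where `v₀ = P u₀`. -/
theorem stmt13 (n p r : ℕ) (A : Fin p → Matrix (Fin n) (Fin n) ℂ)
    (hcomm : ∀ i j, A i * A j = A j * A i)
    (P : (Matrix (Fin n) (Fin n) ℂ)ˣ)
    (hr1 : 1 ≤ r) (hr2 : r ≤ n)
    (nn : Fin r → ℕ) (hpos : ∀ k, 0 < nn k)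
    (e : Fin n ≃ ((k : Fin r) × Fin (nn k)))
    (hconj : ∀ B ∈ genSG A, ∃ b : (k : Fin r) → Matrix (Fin (nn k)) (Fin (nn k)) ℂ,
      (∀ k, IsTn (b k)) ∧
      ((↑P⁻¹ : Matrix (Fin n) (Fin n) ℂ) * B * (P : Matrix (Fin n) (Fin n) ℂ)).submatrix
          e.symm e.symm = Matrix.blockDiagonal' b)
    (u₀ : Fin n → ℂ) (hu₀ : u₀ = fun i => if ((e i).2 : ℕ) = 0 then 1 else 0)
    (v₀ : Fin n → ℂ) (hv₀ : v₀ = (P : Matrix (Fin n) (Fin n) ℂ).mulVec u₀) :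
    ((∃ v : Fin n → ℂ, Dense {w : Fin n → ℂ | ∃ B ∈ genSG A, w = B.mulVec v}) ↔
        JSet A v₀ = Set.univ) ∧
      (JSet A v₀ = Set.univ ↔
        Dense {w : Fin n → ℂ | ∃ B ∈ genSG A, w = B.mulVec v₀}) := by
  have hn : 0 < n := by omega
  have dichotomy : (∀ x, ∃ C ∈ Algebra.adjoin ℂ (genSG A), C *ᵥ v₀ = x) ∨
      ∃ (f g : (Fin n → ℂ) →ₗ[ℂ] ℂ) (χ : genSG A → ℂ), f ≠ 0 ∧ f v₀ = 0 ∧ g v₀ = 1 ∧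
        (∀ (B : genSG A) x, f (B.1 *ᵥ x) = χ B * f x) ∧
        ∀ (B : genSG A) x, g (B.1 *ᵥ x) = χ B * g x := by
    let W : Submodule ℂ (Fin n → ℂ) :=
      (Subalgebra.toSubmodule (Algebra.adjoin ℂ (genSG A))).map ((Matrix.mulVecBilin ℂ ℂ).flip v₀)
    by_cases hW : W = ⊤
    · left
      intro x
      exact (hW ▸ Submodule.mem_top : x ∈ W)
    · right
      obtain ⟨f, χ, hf, hfW, hfχ⟩ := exists_common_eigenfunctional
        (fun B : genSG A => B.1.mulVecLin)
        (fun B C => by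
          rw [Module.End.mul_eq_comp, Module.End.mul_eq_comp, ← Matrix.mulVecLin_mul,
            ← Matrix.mulVecLin_mul, genSG_commute hcomm B.2 C.2]) W hW
        (by
          rintro B _ ⟨C, hC, rfl⟩
          exact ⟨B.1 * C, (Algebra.adjoin ℂ (genSG A)).mul_mem (Algebra.subset_adjoin B.2) hC,
            (Matrix.mulVec_mulVec v₀ B.1 C).symm⟩)
      obtain ⟨g, hg, hgχ⟩ :=
        exists_eigenfunctional_same_weight (genSG A) P nn hpos e hconj f hf χ hfχ
      refine ⟨f, g, χ, hf, hfW _ ⟨1, (Algebra.adjoin ℂ (genSG A)).one_mem, Matrix.one_mulVec v₀⟩, ?_,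
        hfχ, hgχ⟩
      rw [hv₀, hu₀, hg]
  have JSet_of_dense : Dense {w : Fin n → ℂ | ∃ B ∈ genSG A, w = B.mulVec v₀} → JSet A v₀ = Set.univ :=
    JSet_eq_univ_of_dense hn A v₀
  have dense_of_JSet : JSet A v₀ = Set.univ →
      Dense {w : Fin n → ℂ | ∃ B ∈ genSG A, w = B.mulVec v₀} := by
    intro hJ
    rcases dichotomy with hcyc | ⟨f, g, χ, hf, hf0, hg1, hfχ, hgχ⟩
    · exact dense_orbit_of_JSet_eq_univ hcomm hcyc hJ
    · exfalso
      apply hf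
      refine LinearMap.ext fun y => ?_
      obtain ⟨xs, k, hk, hxs, hy⟩ : y ∈ JSet A v₀ := hJ.symm ▸ Set.mem_univ y
      have hfc : Continuous f := f.continuous_of_finiteDimensional
      have hgc : Continuous g := g.continuous_of_finiteDimensional
      have h1 := ((hfc.tendsto y).comp hy).mul ((hgc.tendsto v₀).comp hxs)
      have h2 := ((hgc.tendsto y).comp hy).mul ((hfc.tendsto v₀).comp hxs)
      have heq := tendsto_nhds_unique_of_eventuallyEq h1 h2 (by
        filter_upwards [hk.eventually_gt_atTop 0] with m hm
        have hB : (List.ofFn fun j => A j ^ k m j).prod ∈ genSG A := ⟨k m, hm, rfl⟩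
        have hfB := hfχ ⟨_, hB⟩ (xs m)
        have hgB := hgχ ⟨_, hB⟩ (xs m)
        simp only [Function.comp_apply]
        rw [hfB, hgB]
        ring)
      simpa [hf0, hg1] using heq
  have dense_of_hypercyclic : (∃ v : Fin n → ℂ, Dense {w : Fin n → ℂ | ∃ B ∈ genSG A, w = B.mulVec v}) →
      Dense {w : Fin n → ℂ | ∃ B ∈ genSG A, w = B.mulVec v₀} := by
    rintro ⟨v, hd⟩
    rcases dichotomy with hcyc | ⟨f, g, χ, hf, hf0, hg1, hfχ, hgχ⟩
    · exact dense_orbit_of_dense_orbit hcomm (hcyc v) hd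
    · exfalso
      have hfc : Continuous f := f.continuous_of_finiteDimensional
      have hgc : Continuous g := g.continuous_of_finiteDimensional
      have heq : (fun x => f x * g v) = fun x => g x * f v := by
        refine Continuous.ext_on hd (hfc.mul continuous_const) (hgc.mul continuous_const) ?_
        rintro _ ⟨B, hB, rfl⟩
        simp only [hfχ ⟨B, hB⟩, hgχ ⟨B, hB⟩]
        ring
      have hfv : f v = 0 := by simpa [hf0, hg1, eq_comm] using congrFun heq v₀
      apply hf
      have h0 : (f : (Fin n → ℂ) → ℂ) = fun _ => 0 := by
        refine Continuous.ext_on hd hfc continuous_const ?_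
        rintro _ ⟨B, hB, rfl⟩
        simp [hfχ ⟨B, hB⟩, hfv]
      exact LinearMap.ext fun x => congrFun h0 x
  exact ⟨⟨fun h => JSet_of_dense (dense_of_hypercyclic h), fun h => ⟨v₀, dense_of_JSet h⟩⟩, dense_of_JSet, JSet_of_dense⟩
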